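/- No even integer k with 30 < k ≤ 2·10^11 is a P-integer. -/

import Mathlib

open scoped BigOperators

/-- Number of primes not exceeding the real number `x` (so `primePi x = 0` for `x ≤ 1`). -/
noncomputable def primePi (x : ℝ) : ℕ :=
  ((Finset.range (⌊x⌋₊ + 1)).filter Nat.Prime).card

/-- The `n`-th prime, with `nthPrime 1 = 2`, `nthPrime 2 = 3`, etc. -/
noncomputable def nthPrime (n : ℕ) : ℕ := Nat.nth Nat.Prime (n - 1)
/-- The `i`-th (0-indexed) prime not dividing `k`, in increasing order. -/
noncomputable def nthPrimeNotDvd (k i : ℕ) : ℕ := Nat.nth (fun p => p.Prime ∧ ¬ p ∣ k) i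

/-- `k` is a `P`-integer: `k > 1` and the first `φ(k)` primes not dividing `k` are pairwise
incongruent modulo `k` and their residues are exactly the residues coprime to `k`. -/
def IsPInteger (k : ℕ) : Prop :=
  1 < k ∧
  Set.InjOn (fun i => nthPrimeNotDvd k i % k) (Set.Iio k.totient) ∧
  (fun i => nthPrimeNotDvd k i % k) '' Set.Iio k.totient = {r | r < k ∧ Nat.Coprime r k}

lemma infinite_primes_not_dvd {k : ℕ} (hk : k ≠ 0) :
    {p : ℕ | p.Prime ∧ ¬ p ∣ k}.Infinite := by
  refine Set.infinite_of_not_bddAbove ?_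
  rintro ⟨B, hB⟩
  obtain ⟨p, hp, hpp⟩ := Nat.exists_infinite_primes (max B k + 1)
  have h1 : p ≤ B := hB ⟨hpp, fun h => by
    have := Nat.le_of_dvd (Nat.pos_of_ne_zero hk) h
    omega⟩
  omega

/-- Every residue class coprime to a `P`-integer `k` contains one of the first `φ(k)` primes. -/
lemma IsPInteger.exists_nthPrimeNotDvd {k l : ℕ} (hP : IsPInteger k) (hl : l.Coprime k) :
    ∃ i < k.totient, nthPrimeNotDvd k i % k = l % k := by
  obtain ⟨hk, -, himg⟩ := hP
  have hmem : l % k ∈ {r | r < k ∧ Nat.Coprime r k} :=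
    ⟨Nat.mod_lt _ (by omega), by
      rw [Nat.Coprime, ← Nat.gcd_rec, Nat.gcd_comm]
      exact hl⟩
  rw [← himg] at hmem
  obtain ⟨i, hi, h⟩ := hmem
  exact ⟨i, hi, h⟩

/-- A class without primes up to `x` rules out that `x` exceeds all of the first `φ(k)` primes. -/
lemma IsPInteger.false_of_class_without_primes {k l x : ℕ} (hP : IsPInteger k)
    (hl : l.Coprime k) (hx : ∀ p : ℕ, p.Prime → p ≤ x → p % k ≠ l % k)
    (hcount : k.totient + k.primeFactors.card ≤ Nat.primeCounting x) : False := by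
  have hk : k ≠ 0 := by have := hP.1; omega
  obtain ⟨i, hi, hmod⟩ := hP.exists_nthPrimeNotDvd hl
  have hmem := Nat.nth_mem_of_infinite (infinite_primes_not_dvd hk) i
  refine hx _ hmem.1 ?_ hmod
  have hle : k.totient ≤ Nat.count (fun p : ℕ => p.Prime ∧ ¬ p ∣ k) (x + 1) := by
    rw [Nat.primeCounting, Nat.primeCounting', Nat.count_eq_card_filter_range] at hcount
    rw [Nat.count_eq_card_filter_range]
    have hsub : (Finset.range (x + 1)).filter Nat.Prime ⊆
        (Finset.range (x + 1)).filter (fun p : ℕ => p.Prime ∧ ¬ p ∣ k) ∪ k.primeFactors := by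
      intro p hp
      simp only [Finset.mem_filter, Finset.mem_union, Nat.mem_primeFactors] at hp ⊢
      tauto
    exact Nat.add_le_add_iff_right.1
      (hcount.trans ((Finset.card_le_card hsub).trans (Finset.card_union_le _ _)))
  have := Nat.nth_lt_of_lt_count (hi.trans_le hle)
  exact Nat.lt_succ_iff.mp this

/-- If `p` and `p + k` are primes and a composite (or unit) residue beyond `p` is coprime to `k`,
then `k` is not a `P`-integer. -/
lemma IsPInteger.false_of_prime_pair {k p r : ℕ} (hP : IsPInteger k) (hp : p.Prime)
    (hq : (p + k).Prime) (hr : r.Coprime k) (hrp : ¬ r.Prime) (h1 : p < r) (h2 : r < k) :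
    False := by
  have hk : k ≠ 0 := by have := hP.1; omega
  have hpk : ¬ p ∣ k := fun h => by
    have h3 := (Nat.prime_dvd_prime_iff_eq hp hq).1 ((Nat.dvd_add_right dvd_rfl).2 h)
    omega
  have hqk : ¬ (p + k) ∣ k := fun h => by
    have := Nat.le_of_dvd (Nat.pos_of_ne_zero hk) h
    have := hp.pos
    omega
  have hinf := infinite_primes_not_dvd hk
  obtain ⟨i, hi, hmod⟩ := hP.exists_nthPrimeNotDvd hr
  have hmem := Nat.nth_mem_of_infinite hinf i
  have hrange : ∀ q : ℕ, q.Prime → ¬ q ∣ k → ∃ a, nthPrimeNotDvd k a = q := fun q hq hqk => by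
    have h3 : q ∈ Set.range (Nat.nth fun p : ℕ => p.Prime ∧ ¬ p ∣ k) := by
      rw [Nat.range_nth_of_infinite hinf]
      exact ⟨hq, hqk⟩
    exact h3
  obtain ⟨a, ha⟩ := hrange p hp hpk
  obtain ⟨b, hb⟩ := hrange (p + k) hq hqk
  have hlt : p + k < nthPrimeNotDvd k i := by
    rw [Nat.mod_eq_of_lt h2] at hmod
    have h3 := Nat.div_add_mod (nthPrimeNotDvd k i) k
    rw [hmod] at h3
    rcases Nat.eq_zero_or_pos (nthPrimeNotDvd k i / k) with h0 | h0
    · rw [h0] at h3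
      refine absurd hmem.1 ?_
      change ¬ (nthPrimeNotDvd k i).Prime
      rw [← h3]
      simpa using hrp
    · have := Nat.mul_le_mul_left k h0
      omega
  have hbi : b < i := by
    refine (Nat.nth_strictMono hinf).lt_iff_lt.1 ?_
    change nthPrimeNotDvd k b < nthPrimeNotDvd k i
    rw [hb]
    exact hlt
  have hab : a < b := by
    refine (Nat.nth_strictMono hinf).lt_iff_lt.1 ?_
    change nthPrimeNotDvd k a < nthPrimeNotDvd k b
    rw [hb, ha]
    omega
  have := hP.2.1 (show a ∈ Set.Iio k.totient from by simp only [Set.mem_Iio]; omega)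
    (show b ∈ Set.Iio k.totient from by simp only [Set.mem_Iio]; omega)
    (show nthPrimeNotDvd k a % k = nthPrimeNotDvd k b % k from by
      rw [ha, hb, Nat.add_mod_right])
  omega

open ArithmeticFunction Chebyshev in
lemma log_factorial_eq_sum_vonMangoldt {n N : ℕ} (h : n ≤ N) :
    Real.log n.factorial = ∑ d ∈ Finset.Ioc 0 N, Λ d * (n / d : ℕ) := by
  induction n with
  | zero => simp
  | succ n ih =>
    rw [Nat.factorial_succ, Nat.cast_mul, Real.log_mul (by positivity) (by positivity),
      ih (by omega), ← vonMangoldt_sum, add_comm]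
    have hdiv : ∑ d ∈ (n + 1).divisors, Λ d =
        ∑ d ∈ Finset.Ioc 0 N, Λ d * (if d ∣ n + 1 then 1 else 0 : ℕ) := by
      have : (n + 1).divisors = (Finset.Ioc 0 N).filter (· ∣ n + 1) := by
        ext d
        simp only [Nat.mem_divisors, Finset.mem_filter, Finset.mem_Ioc]
        refine ⟨fun ⟨hd, _⟩ => ⟨⟨Nat.pos_of_dvd_of_pos hd (by omega), ?_⟩, hd⟩,
          fun ⟨_, hd⟩ => ⟨hd, by omega⟩⟩
        exact (Nat.le_of_dvd (by omega) hd).trans h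
      rw [this, Finset.sum_filter]
      refine Finset.sum_congr rfl fun d _ => ?_
      split_ifs <;> simp
    rw [hdiv, ← Finset.sum_add_distrib]
    refine Finset.sum_congr rfl fun d _ => ?_
    rw [Nat.succ_div]
    push_cast
    ring

lemma log_factorial_le {n : ℕ} (hn : 0 < n) :
    Real.log n.factorial ≤ n * Real.log n - n + Real.log n + 1 := by
  induction n, hn using Nat.le_induction with
  | base => simp
  | succ n hn ih =>
    rw [Nat.factorial_succ, Nat.cast_mul, Real.log_mul (by positivity) (by positivity)]
    have hn0 : (0 : ℝ) < n := by exact_mod_cast hn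
    have h1 := Real.one_sub_inv_le_log_of_pos (show (0 : ℝ) < (n + 1) / n by positivity)
    rw [Real.log_div (by positivity) (by positivity), inv_div] at h1
    have h2 : (1 : ℝ) ≤ (n + 1) * (Real.log (n + 1) - Real.log n) := by
      calc (1 : ℝ) = (n + 1) * (1 - n / (n + 1)) := by field_simp; ring
        _ ≤ _ := by gcongr
    push_cast
    linarith

open ArithmeticFunction Chebyshev in
lemma log_factorial_le_psi (n : ℕ) :
    Real.log (30 * n).factorial + Real.log n.factorial - Real.log (15 * n).factorial -
      Real.log (10 * n).factorial - Real.log (6 * n).factorial ≤ ψ (30 * n : ℕ) := by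
  rw [log_factorial_eq_sum_vonMangoldt le_rfl,
    log_factorial_eq_sum_vonMangoldt (show n ≤ 30 * n by omega),
    log_factorial_eq_sum_vonMangoldt (show 15 * n ≤ 30 * n by omega),
    log_factorial_eq_sum_vonMangoldt (show 10 * n ≤ 30 * n by omega),
    log_factorial_eq_sum_vonMangoldt (show 6 * n ≤ 30 * n by omega),
    ← Finset.sum_add_distrib, ← Finset.sum_sub_distrib, ← Finset.sum_sub_distrib,
    ← Finset.sum_sub_distrib, psi, Nat.floor_natCast]
  refine Finset.sum_le_sum fun d _ => ?_
  have h15 : 15 * n / d = 30 * n / d / 2 := by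
    rw [Nat.div_div_eq_div_mul, mul_comm d, ← Nat.div_div_eq_div_mul]
    congr 1; omega
  have h10 : 10 * n / d = 30 * n / d / 3 := by
    rw [Nat.div_div_eq_div_mul, mul_comm d, ← Nat.div_div_eq_div_mul]
    congr 1; omega
  have h6 : 6 * n / d = 30 * n / d / 5 := by
    rw [Nat.div_div_eq_div_mul, mul_comm d, ← Nat.div_div_eq_div_mul]
    congr 1; omega
  have h1 : n / d = 30 * n / d / 30 := by
    rw [Nat.div_div_eq_div_mul, mul_comm d, ← Nat.div_div_eq_div_mul]
    congr 1; omega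
  have hle : 30 * n / d + n / d ≤ 15 * n / d + 10 * n / d + 6 * n / d + 1 := by
    rw [h15, h10, h6, h1]; omega
  have hle' : ((30 * n / d : ℕ) : ℝ) + (n / d : ℕ) ≤
      (15 * n / d : ℕ) + (10 * n / d : ℕ) + (6 * n / d : ℕ) + 1 := by exact_mod_cast hle
  have := vonMangoldt_nonneg (n := d)
  nlinarith

set_option exponentiation.threshold 2211 in
lemma chebyshev_constant_le :
    (2211 / 80 : ℝ) ≤ 14 * Real.log 2 + 9 * Real.log 3 + 5 * Real.log 5 := by
  have h : (2211 : ℝ) ≤ Real.log ((2 ^ 14 * 3 ^ 9 * 5 ^ 5) ^ 80) := by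
    rw [Real.le_log_iff_exp_le (by positivity), show (2211 : ℝ) = (2211 : ℕ) * 1 by norm_num,
      Real.exp_nat_mul]
    calc Real.exp 1 ^ 2211 ≤ (2.7182818286 : ℝ) ^ 2211 := by
          gcongr
          exact Real.exp_one_lt_d9.le
      _ ≤ _ := by norm_num
  rw [Real.log_pow, Real.log_mul (by positivity) (by positivity),
    Real.log_mul (by positivity) (by positivity), Real.log_pow, Real.log_pow, Real.log_pow] at h
  push_cast at h
  linarith

open Chebyshev in
/-- Chebyshev's lower bound for `ψ`. -/
lemma le_psi {x : ℕ} (hx : 10 ^ 7 ≤ x) : 0.9212 * (x : ℝ) ≤ ψ x := by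
  set n := x / 30 with hn
  have hn0 : 0 < n := by omega
  have hpos : (0 : ℝ) < n := by exact_mod_cast hn0
  have hpsi := (log_factorial_le_psi n).trans
    (psi_mono (show ((30 * n : ℕ) : ℝ) ≤ (x : ℝ) by exact_mod_cast (by omega)))
  have l30 := Stirling.le_log_factorial_stirling (show 30 * n ≠ 0 by omega)
  have l1 := Stirling.le_log_factorial_stirling hn0.ne'
  have u15 := log_factorial_le (show 0 < 15 * n by omega)
  have u10 := log_factorial_le (show 0 < 10 * n by omega)
  have u6 := log_factorial_le (show 0 < 6 * n by omega)
  have hlog : ∀ a b : ℝ, 0 < a → 0 < b → Real.log (a * b) = Real.log a + Real.log b :=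
    fun a b ha hb => Real.log_mul ha.ne' hb.ne'
  have e30 : Real.log 30 = Real.log 2 + Real.log 3 + Real.log 5 := by
    rw [← hlog _ _ (by norm_num) (by norm_num), ← hlog _ _ (by norm_num) (by norm_num)]; norm_num
  have e15 : Real.log 15 = Real.log 3 + Real.log 5 := by
    rw [← hlog _ _ (by norm_num) (by norm_num)]; norm_num
  have e10 : Real.log 10 = Real.log 2 + Real.log 5 := by
    rw [← hlog _ _ (by norm_num) (by norm_num)]; norm_num
  have e6 : Real.log 6 = Real.log 2 + Real.log 3 := by
    rw [← hlog _ _ (by norm_num) (by norm_num)]; norm_num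
  have hpi : 0 ≤ Real.log (2 * Real.pi) := Real.log_nonneg (by linarith [Real.pi_gt_three])
  push_cast at l30 l1 u15 u10 u6 hpsi
  rw [hlog _ _ (by norm_num) hpos, e30] at l30
  rw [hlog _ _ (by norm_num) hpos, e15] at u15
  rw [hlog _ _ (by norm_num) hpos, e10] at u10
  rw [hlog _ _ (by norm_num) hpos, e6] at u6
  have hlogn : Real.log n ≤ 63 + n / 10 ^ 7 := by
    have h1 := Real.log_le_sub_one_of_pos (show (0 : ℝ) < n / 10 ^ 7 by positivity)
    rw [Real.log_div (by positivity) (by positivity), Real.log_pow] at h1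
    have h2 := Real.log_le_sub_one_of_pos (show (0 : ℝ) < 10 by norm_num)
    push_cast at h1
    linarith
  have h2 := Real.log_le_sub_one_of_pos (show (0 : ℝ) < 2 by norm_num)
  have h3 := Real.log_le_sub_one_of_pos (show (0 : ℝ) < 3 by norm_num)
  have h5 := Real.log_le_sub_one_of_pos (show (0 : ℝ) < 5 by norm_num)
  have hc := mul_le_mul_of_nonneg_left chebyshev_constant_le hpos.le
  have hxn : (x : ℝ) ≤ 30 * n + 30 := by exact_mod_cast (by omega)
  have hx' : (10 : ℝ) ^ 7 ≤ x := by exact_mod_cast hx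
  nlinarith

open Chebyshev in
/-- Chebyshev's lower bound for the prime counting function. -/
lemma le_primeCounting_mul_log {x : ℕ} (hx : 10 ^ 7 ≤ x) :
    0.9212 * (x : ℝ) ≤ Nat.primeCounting x * Real.log x :=
  (le_psi hx).trans (psi_le_primeCounting_mul_log x)

/-- If every window of length `G` contains an integer coprime to `k`, then so does every
arithmetic progression of length `G` whose difference is coprime to `k`. -/
lemma exists_coprime_progression {k m G : ℕ} (hk : 1 < k) (hm : m.Coprime k)
    (hG : ∀ u, ∃ i < G, (u + i).Coprime k) (s : ℕ) : ∃ i < G, (s + i * m).Coprime k := by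
  obtain ⟨v, hv⟩ := Nat.exists_mul_mod_eq_one_of_coprime hm hk
  obtain ⟨i, hi, hcop⟩ := hG (s * v)
  refine ⟨i, hi, ?_⟩
  have h1 : m * v ≡ 1 [MOD k] := by
    rw [Nat.ModEq, hv.2, Nat.mod_eq_of_lt hk]
  have h2 : m * (s * v + i) ≡ s + i * m [MOD k] := by
    calc m * (s * v + i) = s * (m * v) + i * m := by ring
      _ ≡ s * 1 + i * m [MOD k] := (h1.mul_left s).add_right _
      _ = s + i * m := by ring
  rw [Nat.Coprime, ← h2.gcd_eq]
  exact hm.mul_left hcop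

lemma exists_coprime_in_covered_class {k G : ℕ} {C : List (ℕ × ℕ)} (hk : 1 < k)
    (hprime : ∀ c ∈ C, c.1.Prime ∧ ¬ c.1 ∣ k) (hnodup : (C.map Prod.fst).Nodup)
    (hG : ∀ u, ∃ i < G, (u + i).Coprime k) (hle : (C.map Prod.fst).prod * G ≤ k) :
    ∃ l, l.Coprime k ∧ k < l + (C.map Prod.fst).prod * G ∧ l ≤ k ∧
      ∀ c ∈ C, c.1 ∣ l + c.2 * k := by
  set m := (C.map Prod.fst).prod with hm
  have hpair : C.Pairwise (Function.onFun Nat.Coprime Prod.fst) := by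
    rw [List.Nodup, List.pairwise_map] at hnodup
    refine hnodup.imp_of_mem fun {a b} ha hb hab => ?_
    exact (Nat.coprime_primes (hprime a ha).1 (hprime b hb).1).2 hab
  obtain ⟨c, hc⟩ := Nat.chineseRemainderOfList
    (fun x : ℕ × ℕ => (x.1 - 1) * (x.2 * k)) Prod.fst C hpair
  have hmpos : 0 < m := by
    refine Nat.pos_of_ne_zero fun h => ?_
    rw [hm, List.prod_eq_zero_iff, List.mem_map] at h
    obtain ⟨x, hx, hx0⟩ := h
    exact (hprime x hx).1.ne_zero hx0
  have hmk : m.Coprime k := by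
    refine Nat.coprime_list_prod_left_iff.2 fun q hq => ?_
    obtain ⟨x, hx, rfl⟩ := List.mem_map.1 hq
    exact (Nat.Prime.coprime_iff_not_dvd (hprime x hx).1).2 (hprime x hx).2
  have hGpos : 0 < G := by
    obtain ⟨i, hi, -⟩ := hG 0
    omega
  obtain ⟨s, hs, hs1, hs2⟩ : ∃ s, s ≡ c [MOD m] ∧ k - m * G + 1 ≤ s ∧ s ≤ k - m * G + m := by
    set w := k - m * G + 1
    refine ⟨w + (c + (m - 1) * w) % m, ?_, by omega, ?_⟩
    · calc w + (c + (m - 1) * w) % m ≡ w + (c + (m - 1) * w) [MOD m] :=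
            (Nat.mod_modEq _ _).add_left _
        _ = c + m * w := by
            have : (m - 1) * w + w = m * w := by
              rw [← Nat.succ_mul, Nat.succ_eq_add_one, Nat.sub_add_cancel hmpos]
            omega
        _ ≡ c + 0 [MOD m] := Nat.ModEq.add_left _ (by simp [Nat.ModEq])
    · have := Nat.mod_lt (c + (m - 1) * w) hmpos
      omega
  obtain ⟨i, hi, hcop⟩ := exists_coprime_progression hk hmk hG s
  have him : i * m + m ≤ m * G := by
    calc i * m + m = m * (i + 1) := by ring
      _ ≤ m * G := Nat.mul_le_mul_left _ hi
  refine ⟨s + i * m, hcop, by omega, by omega, fun x hx => ?_⟩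
  have hdvd : x.1 ∣ m := List.dvd_prod (List.mem_map_of_mem hx)
  have hxpos := (hprime x hx).1.pos
  have h1 : s + i * m + x.2 * k ≡ 0 [MOD x.1] := by
    calc s + i * m + x.2 * k ≡ s + 0 + x.2 * k [MOD x.1] :=
          (Nat.ModEq.add_left _
            ((Nat.modEq_zero_iff_dvd).2 (hdvd.mul_left i))).add_right _
      _ ≡ (x.1 - 1) * (x.2 * k) + x.2 * k [MOD x.1] :=
          ((hs.of_dvd hdvd).trans (hc x hx)).add_right _
      _ = x.1 * (x.2 * k) := by
          obtain ⟨q, hq⟩ : ∃ q, x.1 = q + 1 := ⟨x.1 - 1, by omega⟩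
          rw [hq, Nat.add_sub_cancel]; ring
      _ ≡ 0 [MOD x.1] := by simp [Nat.ModEq]
  exact (Nat.modEq_zero_iff_dvd).1 h1

/-- A covering of `{0, …, T - 1}` by residue classes modulo primes not dividing `k` produces
a residue class modulo `k` whose members up to `(T + 1) k - m G` are all composite. -/
lemma IsPInteger.false_of_cover {k G T : ℕ} {C : List (ℕ × ℕ)} (hP : IsPInteger k)
    (hprime : ∀ c ∈ C, c.1.Prime ∧ ¬ c.1 ∣ k) (hnodup : (C.map Prod.fst).Nodup)
    (hG : ∀ u, ∃ i < G, (u + i).Coprime k)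
    (hle : ∀ c ∈ C, (C.map Prod.fst).prod * G + c.1 ≤ k) (hC : C ≠ [])
    (hcov : ∀ j < T, ∃ c ∈ C, j ≡ c.2 [MOD c.1])
    (hcount : k.totient + k.primeFactors.card ≤
      Nat.primeCounting ((T + 1) * k - (C.map Prod.fst).prod * G)) : False := by
  have hk := hP.1
  obtain ⟨c, hc⟩ := List.exists_mem_of_ne_nil C hC
  obtain ⟨l, hl, hlo, hhi, hdvd⟩ := exists_coprime_in_covered_class hk hprime hnodup hG
    ((Nat.le_add_right _ _).trans (hle c hc))
  refine hP.false_of_class_without_primes hl (fun p hp hpx hpl => ?_) hcount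
  have hlk : l < k := by
    refine lt_of_le_of_ne hhi fun h => ?_
    rw [h, Nat.coprime_self] at hl
    omega
  rw [Nat.mod_eq_of_lt hlk] at hpl
  have hdiv := Nat.div_add_mod p k
  rw [hpl] at hdiv
  by_cases hj : p / k < T
  · obtain ⟨x, hx, hxj⟩ := hcov _ hj
    have h1 : x.1 ∣ p := by
      refine (Nat.modEq_zero_iff_dvd).1 ?_
      calc p = l + p / k * k := by rw [mul_comm (p / k)]; omega
        _ ≡ l + x.2 * k [MOD x.1] := (hxj.mul_right k).add_left l
        _ ≡ 0 [MOD x.1] := (Nat.modEq_zero_iff_dvd).2 (hdvd x hx)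
    have h2 := (Nat.prime_dvd_prime_iff_eq (hprime x hx).1 hp).1 h1
    have h3 := hle x hx
    have h4 := Nat.zero_le (k * (p / k))
    omega
  · have h1 : k * T ≤ k * (p / k) := Nat.mul_le_mul_left _ (by omega)
    have h2 : (T + 1) * k = k * T + k := by ring
    have h3 := hle c hc
    omega

/-- The number of integers coprime to `b` in the window `[u, u + L)`. -/
def coprimeCount (b u L : ℕ) : ℕ := ((Finset.range L).filter fun i => (u + i).Coprime b).card

lemma coprimeCount_mod (b u L : ℕ) : coprimeCount b (u % b) L = coprimeCount b u L := by
  unfold coprimeCount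
  congr 1
  ext i
  simp only [Finset.mem_filter, Nat.Coprime]
  rw [((Nat.mod_modEq u b).add_right i).gcd_eq]

lemma card_multiples_le_of_coprimeCount_le {b p L c M : ℕ} (hp : 0 < p) (hL : L ≤ c * p)
    (hM : ∀ v, coprimeCount b v c ≤ M) (u : ℕ) :
    ((Finset.range L).filter fun i => (u + i).Coprime b ∧ p ∣ u + i).card ≤ M := by
  refine le_trans ?_ (hM ((u + p - 1) / p))
  set v := (u + p - 1) / p with hv
  have hv1 : u ≤ p * v := by
    have h1 := Nat.div_add_mod (u + p - 1) p
    have h2 := Nat.mod_lt (u + p - 1) hp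
    rw [← hv] at h1
    omega
  have hv2 : p * v < u + p := by
    have := Nat.mul_div_le (u + p - 1) p
    rw [← hv] at this
    omega
  have hvw : ∀ w i, u + i = p * w → v ≤ w := fun w i h => by
    by_contra! hlt
    have := Nat.mul_le_mul_left p (show w + 1 ≤ v from hlt)
    rw [mul_add] at this
    omega
  refine Finset.card_le_card_of_injOn (fun i => (u + i) / p - v) ?_ ?_
  · intro i hi
    simp only [Finset.coe_filter, Finset.mem_range, Set.mem_ofPred_eq] at hi ⊢
    obtain ⟨hi, hcop, w, hw⟩ := hi
    rw [hw, Nat.mul_div_cancel_left _ hp]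
    have h1 := hvw w i hw
    refine ⟨?_, ?_⟩
    · by_contra! hlt
      have := Nat.mul_le_mul_left p (show v + c ≤ w by omega)
      rw [mul_add, mul_comm p c] at this
      omega
    · rw [Nat.add_sub_cancel' h1]
      rw [hw] at hcop
      exact Nat.Coprime.coprime_mul_left hcop
  · intro i hi j hj hij
    simp only [Finset.coe_filter, Finset.mem_range, Set.mem_ofPred_eq] at hi hj hij
    obtain ⟨-, -, w, hw⟩ := hi
    obtain ⟨-, -, z, hz⟩ := hj
    rw [hw, hz, Nat.mul_div_cancel_left _ hp, Nat.mul_div_cancel_left _ hp] at hij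
    have h1 := hvw w i hw
    have h2 := hvw z j hz
    have : w = z := by omega
    subst this
    omega

lemma card_biUnion_toFinset_le {α : Type*} [DecidableEq α] (S : List ℕ) (f : ℕ → Finset α)
    (g : ℕ → ℕ) (h : ∀ p ∈ S, (f p).card ≤ g p) :
    (S.toFinset.biUnion f).card ≤ (S.map g).sum := by
  induction S with
  | nil => simp
  | cons p S ih =>
    rw [List.toFinset_cons, Finset.biUnion_insert, List.map_cons, List.sum_cons]
    exact (Finset.card_union_le _ _).trans (Nat.add_le_add (h p (by simp))
      (ih fun q hq => h q (by simp [hq])))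

/-- A counting sieve bounding the gaps between integers coprime to `k`. -/
lemma exists_coprime_in_window {k b L h nxt t : ℕ} {S : List ℕ} {M : ℕ → ℕ} (hk : k ≠ 0)
    (hlow : ∀ u, h ≤ coprimeCount b u L) (hup : ∀ c v, coprimeCount b v c ≤ M c)
    (hS : ∀ p ∈ S, 0 < p) (hnxt : 0 < nxt)
    (hfac : ∀ p, p.Prime → p ∣ k → p ∣ b ∨ p ∈ S ∨ nxt ≤ p)
    (ht : (k.primeFactors.filter (nxt ≤ ·)).card ≤ t)
    (hsum : (S.map fun p => M ((L + p - 1) / p)).sum + t * M ((L + nxt - 1) / nxt) < h)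
    (u : ℕ) : ∃ i < L, (u + i).Coprime k := by
  by_contra! hno
  have hceil : ∀ p, 0 < p → L ≤ (L + p - 1) / p * p := fun p hp => by
    have h1 := Nat.div_add_mod' (L + p - 1) p
    have h2 := Nat.mod_lt (L + p - 1) hp
    omega
  set f : ℕ → Finset ℕ := fun p =>
    (Finset.range L).filter fun i => (u + i).Coprime b ∧ p ∣ u + i
  have h1 : (S.toFinset.biUnion f).card ≤ (S.map fun p => M ((L + p - 1) / p)).sum := by
    refine card_biUnion_toFinset_le S f _ fun p hp => ?_
    exact card_multiples_le_of_coprimeCount_le (hS p hp) (hceil p (hS p hp)) (hup _) u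
  have h2 : ((k.primeFactors.filter (nxt ≤ ·)).biUnion f).card ≤
      t * M ((L + nxt - 1) / nxt) := by
    refine (Finset.card_biUnion_le_card_mul _ _ (M ((L + nxt - 1) / nxt)) fun p hp => ?_).trans
      (Nat.mul_le_mul_right _ ht)
    simp only [Finset.mem_filter, Nat.mem_primeFactors] at hp
    exact card_multiples_le_of_coprimeCount_le hp.1.1.pos
      ((hceil nxt hnxt).trans (Nat.mul_le_mul_left _ hp.2)) (hup _) u
  have h3 : ((Finset.range L).filter fun i => (u + i).Coprime b) ⊆
      S.toFinset.biUnion f ∪ (k.primeFactors.filter (nxt ≤ ·)).biUnion f := by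
    intro i hi
    simp only [Finset.mem_filter, Finset.mem_range] at hi
    obtain ⟨p, hp, hpu, hpk⟩ := Nat.Prime.not_coprime_iff_dvd.1 (hno i hi.1)
    have hif : i ∈ f p := by
      simp only [f, Finset.mem_filter, Finset.mem_range]
      exact ⟨hi.1, hi.2, hpu⟩
    rw [Finset.mem_union, Finset.mem_biUnion, Finset.mem_biUnion]
    rcases hfac p hp hpk with h | h | h
    · exact absurd hi.2 (Nat.Prime.not_coprime_iff_dvd.2 ⟨p, hp, hpu, h⟩)
    · exact Or.inl ⟨p, List.mem_toFinset.2 h, hif⟩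
    · refine Or.inr ⟨p, ?_, hif⟩
      simp only [Finset.mem_filter, Nat.mem_primeFactors]
      exact ⟨⟨hp, hpk, hk⟩, h⟩
  have h4 := (Finset.card_le_card h3).trans (Finset.card_union_le _ _)
  have h5 := hlow u
  unfold coprimeCount at h5
  omega

lemma totient_mul_prod_le {k : ℕ} {S : List ℕ} (hk : k ≠ 0) (hnodup : S.Nodup)
    (hS : ∀ p ∈ S, p.Prime ∧ p ∣ k) :
    k.totient * S.prod ≤ k * (S.map (· - 1)).prod := by
  have hsub : S.toFinset ⊆ k.primeFactors := fun p hp => by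
    rw [List.mem_toFinset] at hp
    exact Nat.mem_primeFactors.2 ⟨(hS p hp).1, (hS p hp).2, hk⟩
  have h := Nat.totient_mul_prod_primeFactors k
  rw [← Finset.prod_sdiff hsub, ← Finset.prod_sdiff (f := fun p => p - 1) hsub] at h
  rw [List.prod_toFinset _ hnodup, List.prod_toFinset _ hnodup, List.map_id'] at h
  have hpos : 0 < ∏ p ∈ k.primeFactors \ S.toFinset, p := Finset.prod_pos fun p hp =>
    (Nat.prime_of_mem_primeFactors (Finset.sdiff_subset hp)).pos
  have hle : ∏ p ∈ k.primeFactors \ S.toFinset, (p - 1) ≤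
      ∏ p ∈ k.primeFactors \ S.toFinset, p :=
    Finset.prod_le_prod (fun _ _ => Nat.zero_le _) fun p _ => Nat.sub_le p 1
  refine Nat.le_of_mul_le_mul_left ?_ hpos
  calc _ = k.totient * ((∏ p ∈ k.primeFactors \ S.toFinset, p) * S.prod) := by ring
    _ = k * ((∏ p ∈ k.primeFactors \ S.toFinset, (p - 1)) * (S.map (· - 1)).prod) := h
    _ ≤ k * ((∏ p ∈ k.primeFactors \ S.toFinset, p) * (S.map (· - 1)).prod) := by gcongr
    _ = _ := by ring

/-- Primes dividing `k` beyond a given list contribute at least `nxt` each. -/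
lemma prod_mul_pow_card_le {k nxt : ℕ} {S : List ℕ} (hk : k ≠ 0) (hnodup : S.Nodup)
    (hS : ∀ p ∈ S, p.Prime ∧ p ∣ k ∧ p < nxt) :
    S.prod * nxt ^ (k.primeFactors.filter (nxt ≤ ·)).card ≤ k := by
  have hdisj : Disjoint S.toFinset (k.primeFactors.filter (nxt ≤ ·)) := by
    rw [Finset.disjoint_left]
    intro p hp hp'
    rw [List.mem_toFinset] at hp
    have := (hS p hp).2.2
    have := (Finset.mem_filter.1 hp').2
    omega
  have hsub : S.toFinset ∪ k.primeFactors.filter (nxt ≤ ·) ⊆ k.primeFactors := by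
    refine Finset.union_subset (fun p hp => ?_) (Finset.filter_subset _ _)
    rw [List.mem_toFinset] at hp
    exact Nat.mem_primeFactors.2 ⟨(hS p hp).1, (hS p hp).2.1, hk⟩
  calc S.prod * nxt ^ (k.primeFactors.filter (nxt ≤ ·)).card
      ≤ S.prod * ∏ p ∈ k.primeFactors.filter (nxt ≤ ·), p :=
        Nat.mul_le_mul_left _ (Finset.pow_card_le_prod _ _ _ fun p hp =>
          (Finset.mem_filter.1 hp).2)
    _ = ∏ p ∈ S.toFinset ∪ k.primeFactors.filter (nxt ≤ ·), p := by
        rw [Finset.prod_union hdisj, List.prod_toFinset _ hnodup, List.map_id']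
    _ ≤ k := Nat.le_of_dvd (Nat.pos_of_ne_zero hk)
        ((Finset.prod_dvd_prod_of_subset _ _ _ hsub).trans (Nat.prod_primeFactors_dvd k))

lemma two_pow_card_primeFactors_le {k : ℕ} (hk : k ≠ 0) : 2 ^ k.primeFactors.card ≤ k :=
  (Finset.pow_card_le_prod _ _ _ fun _ hp => (Nat.prime_of_mem_primeFactors hp).two_le).trans
    (Nat.le_of_dvd (Nat.pos_of_ne_zero hk) (Nat.prod_primeFactors_dvd k))

/-- If at most `t` members of an increasing list divide `k`, then `n` members not dividing `k`
can be chosen with product at most that of the members in positions `t, …, t + n - 1`. -/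
lemma exists_sublist_not_dvd (k : ℕ) (ps : List ℕ) (t n : ℕ) (hsorted : ps.Pairwise (· < ·))
    (ht : (ps.filter (· ∣ k)).length ≤ t) (hn : t + n ≤ ps.length) :
    ∃ E : List ℕ, E.Sublist ps ∧ E.length = n ∧ (∀ p ∈ E, ¬ p ∣ k) ∧
      E.prod ≤ ((ps.drop t).take n).prod := by
  induction ps generalizing t n with
  | nil =>
    obtain rfl : n = 0 := by simp at hn; omega
    exact ⟨[], by simp⟩
  | cons p ps ih =>
    rw [List.pairwise_cons] at hsorted
    rw [List.length_cons] at hn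
    rcases Nat.eq_zero_or_pos n with rfl | hnpos
    · exact ⟨[], by simp⟩
    obtain ⟨n, rfl⟩ : ∃ n', n = n' + 1 := ⟨n - 1, by omega⟩
    by_cases hp : p ∣ k
    · rw [List.filter_cons_of_pos (by simpa using hp), List.length_cons] at ht
      obtain ⟨t, rfl⟩ : ∃ t', t = t' + 1 := ⟨t - 1, by omega⟩
      obtain ⟨E, h1, h2, h3, h4⟩ := ih t (n + 1) hsorted.2 (by omega) (by omega)
      exact ⟨E, h1.cons p, h2, h3, by simpa using h4⟩
    · rw [List.filter_cons_of_neg (by simpa using hp)] at ht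
      obtain ⟨E, h1, h2, h3, h4⟩ := ih t n hsorted.2 ht (by omega)
      refine ⟨p :: E, h1.cons_cons p, by simp [h2], ?_, ?_⟩
      · simpa using ⟨hp, h3⟩
      · have hlt : t < (p :: ps).length := by rw [List.length_cons]; omega
        rw [List.drop_eq_getElem_cons hlt, List.take_succ_cons, List.prod_cons, List.prod_cons,
          List.drop_succ_cons]
        refine Nat.mul_le_mul ?_ h4
        rcases t with _ | t
        · simp
        · rw [List.getElem_cons_succ]
          exact (hsorted.1 _ (List.getElem_mem _)).le

/-- A certificate for `Real.log x ≤ L / 1000`. -/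
def LogBound (x L : ℕ) : Prop := x ^ 1000 * 10 ^ (10 * L) ≤ 27182818283 ^ L

instance (x L : ℕ) : Decidable (LogBound x L) := inferInstanceAs (Decidable (_ ≤ _))

lemma LogBound.log_le {x L : ℕ} (hx : 0 < x) (h : LogBound x L) :
    Real.log x ≤ (L : ℝ) / 1000 := by
  have hcast : ((x : ℝ) ^ 1000) * (10 ^ 10) ^ L ≤ 27182818283 ^ L := by
    rw [← pow_mul]
    exact_mod_cast h
  have h1 : (x : ℝ) ^ 1000 ≤ Real.exp L := by
    calc (x : ℝ) ^ 1000 ≤ 27182818283 ^ L / (10 ^ 10) ^ L := by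
          rwa [le_div_iff₀ (by positivity)]
      _ = (2.7182818283 : ℝ) ^ L := by rw [← div_pow]; norm_num
      _ ≤ Real.exp 1 ^ L := by
          gcongr
          exact Real.exp_one_gt_d9.le
      _ = Real.exp L := by rw [← Real.exp_nat_mul, mul_one]
  have hx' : (0 : ℝ) < x := by exact_mod_cast hx
  have h2 := Real.log_le_log (by positivity) h1
  rw [Real.log_exp, Real.log_pow] at h2
  push_cast at h2
  linarith

/-- Chebyshev's bound turned into a linear inequality between integers. -/
lemma totient_add_le_primeCounting {k K₁ K₂ A B T m G ell lt : ℕ} (hB : 0 < B) (hT : 1 ≤ T)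
    (hK : 10 ^ 7 ≤ K₁) (h1 : K₁ ≤ k) (h2 : k ≤ K₂) (hφ : k.totient * B ≤ k * A)
    (hω : k.primeFactors.card ≤ 37) (hell : LogBound K₂ ell) (hlt : LogBound (T + 1) lt)
    (hm : m * G ≤ K₁)
    (h : 10 * (ell + lt) * (A * K₁ + 37 * B) + 9212 * B * (m * G) ≤ 9212 * B * (T + 1) * K₁) :
    k.totient + k.primeFactors.card ≤ Nat.primeCounting ((T + 1) * k - m * G) := by
  have hmk : m * G ≤ k := hm.trans h1
  have hTk : k ≤ T * k := Nat.le_mul_of_pos_left k hT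
  have hexp : (T + 1) * k = T * k + k := by ring
  set x := (T + 1) * k - m * G with hxdef
  have hx : 10 ^ 7 ≤ x := by omega
  have hcheb := le_primeCounting_mul_log hx
  have hxpos : (0 : ℝ) < x := by exact_mod_cast (by omega)
  have hlog : Real.log x ≤ ((ell + lt : ℕ) : ℝ) / 1000 := by
    calc Real.log x ≤ Real.log (((T + 1 : ℕ) : ℝ) * (K₂ : ℝ)) := by
          refine Real.log_le_log hxpos ?_
          exact_mod_cast (Nat.sub_le _ _).trans (Nat.mul_le_mul_left _ h2)
      _ = Real.log ((T + 1 : ℕ) : ℝ) + Real.log (K₂ : ℝ) := by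
          refine Real.log_mul ?_ ?_
          · exact_mod_cast Nat.succ_ne_zero T
          · exact_mod_cast (by omega : K₂ ≠ 0)
      _ ≤ (lt : ℝ) / 1000 + (ell : ℝ) / 1000 :=
          add_le_add (hlt.log_le (Nat.succ_pos T)) (hell.log_le (by omega))
      _ = _ := by push_cast; ring
  have hmain : (9212 : ℝ) * x ≤ Nat.primeCounting x * (10 * (ell + lt : ℕ)) := by
    have := mul_le_mul_of_nonneg_left hlog (Nat.cast_nonneg (α := ℝ) (Nat.primeCounting x))
    linarith
  have hmain' : 9212 * x ≤ Nat.primeCounting x * (10 * (ell + lt)) := by exact_mod_cast hmain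
  have hslope : 10 * (ell + lt) * A ≤ 9212 * B * (T + 1) := by
    refine Nat.le_of_mul_le_mul_right ?_ (show 0 < K₁ by omega)
    calc 10 * (ell + lt) * A * K₁ ≤ 10 * (ell + lt) * (A * K₁ + 37 * B) := by
          rw [mul_assoc]; exact Nat.mul_le_mul_left _ (Nat.le_add_right _ _)
      _ ≤ _ := by omega
  obtain ⟨d, rfl⟩ := Nat.exists_eq_add_of_le h1
  have hlin : 10 * (ell + lt) * (A * (K₁ + d) + 37 * B) ≤ 9212 * B * x := by
    have hxx : x + m * G = (T + 1) * (K₁ + d) := by omega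
    have e1 : 9212 * B * x + 9212 * B * (m * G) = 9212 * B * (T + 1) * (K₁ + d) := by
      rw [← mul_add, hxx]; ring
    have e2 := Nat.mul_le_mul_right d hslope
    have e3 : 10 * (ell + lt) * (A * (K₁ + d) + 37 * B) =
        10 * (ell + lt) * (A * K₁ + 37 * B) + 10 * (ell + lt) * A * d := by ring
    have e4 : 9212 * B * (T + 1) * (K₁ + d) =
        9212 * B * (T + 1) * K₁ + 9212 * B * (T + 1) * d := by ring
    omega
  have hellpos : 0 < ell + lt := by
    by_contra! h0
    have h0 : ell + lt = 0 := by omega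
    rw [h0] at hmain'
    omega
  refine (Nat.add_le_add_left hω _).trans ?_
  refine Nat.le_of_mul_le_mul_left ?_ (show 0 < 10 * (ell + lt) * B by positivity)
  calc 10 * (ell + lt) * B * ((K₁ + d).totient + 37)
      = 10 * (ell + lt) * ((K₁ + d).totient * B + 37 * B) := by ring
    _ ≤ 10 * (ell + lt) * (A * (K₁ + d) + 37 * B) := by
        rw [mul_comm A]; gcongr
    _ ≤ 9212 * B * x := hlin
    _ = B * (9212 * x) := by ring
    _ ≤ B * (Nat.primeCounting x * (10 * (ell + lt))) := Nat.mul_le_mul_left _ hmain'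
    _ = _ := by ring

/-- Positions below `T` missed by the given residue classes. -/
def uncovered (Q : List (ℕ × ℕ)) (T : ℕ) : List ℕ :=
  (List.range T).filter fun j => Q.all fun c => !Nat.beq (j % c.1) c.2

/-- The final numerical comparison for a covering with modulus at most `m`. -/
def boundCheck (K₁ L A B T G m : ℕ) : Bool :=
  Nat.ble (m * G + 200) K₁ &&
    Nat.ble (10 * L * (A * K₁ + 37 * B) + 9212 * B * (m * G)) (9212 * B * (T + 1) * K₁)

/-- Fill `s` uncovered positions with the primes `N` known not to divide `k`, then with primes
from `ps`, of which at most `t` divide `k`. -/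
def fillCheck (K₁ L A B T G t s : ℕ) (Q : List (ℕ × ℕ)) (N ps : List ℕ) : Bool :=
  Nat.ble (t + (s - N.length)) ps.length &&
    boundCheck K₁ L A B T G
      ((Q.map Prod.fst).prod * (N.take s).prod * ((ps.drop t).take (s - N.length)).prod)

/-- Try to cover `T` positions, for each `T` in the table `Ts` of pairs `(T, 1000 log (T + 1))`. -/
def coverCheck (Ts : List (ℕ × ℕ)) (K₁ ell A B G t : ℕ) (Qs : List (List (ℕ × ℕ)))
    (N ps : List ℕ) : Bool :=
  Ts.any fun x =>
    Nat.blt (10 * (ell + x.2) * (A * K₁ + 37 * B)) (9212 * B * (x.1 + 1) * K₁) &&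
      Qs.any fun Q => fillCheck K₁ (ell + x.2) A B x.1 G t (uncovered Q x.1).length Q N ps

/-- The number of factors at least `nxt` that fit below `K` after `r`. -/
def maxFactors (K nxt : ℕ) : ℕ → ℕ → ℕ
  | 0, _ => 0
  | n + 1, r => bif Nat.blt K (r * nxt) then 0 else maxFactors K nxt n (r * nxt) + 1

/-- Data for the counting sieve with base `b`: pairs of a window length and a lower bound for the
number of integers coprime to `b` in it, and upper bounds for windows of length `0, 1, 2, …`. -/
structure SieveData where
  b : ℕ
  windows : List (ℕ × ℕ)
  maxima : List ℕ

/-- The upper bound for the number of integers coprime to the base in a window of length `c`. -/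
def SieveData.maxCount (D : SieveData) (c : ℕ) : ℕ := D.maxima.getD c c

/-- A window length in which the counting sieve finds an integer coprime to `k`. -/
def SieveData.findWindow (D : SieveData) (S : List ℕ) (t nxt : ℕ) : Option (ℕ × ℕ) :=
  D.windows.find? fun w =>
    Nat.blt ((S.map fun p => D.maxCount ((w.1 + p - 1) / p)).sum +
      t * D.maxCount ((w.1 + nxt - 1) / nxt)) w.2

def SieveData.Valid (D : SieveData) : Prop :=
  0 < D.b ∧ 2 ∣ D.b ∧ (∀ w ∈ D.windows, ∀ u < D.b, w.2 ≤ coprimeCount D.b u w.1) ∧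
    ∀ c < D.maxima.length, ∀ u < D.b, coprimeCount D.b u c ≤ D.maxima.getD c c

instance (D : SieveData) : Decidable D.Valid := inferInstanceAs (Decidable (_ ∧ _))

def leafCheckAux (Ts : List (ℕ × ℕ)) (K₁ K₂ ell A B t nxt : ℕ) (Qs : List (List (ℕ × ℕ)))
    (N ps : List ℕ) : Option (ℕ × ℕ) → Bool
  | none => false
  | some w => Nat.blt K₂ (B * nxt ^ (t + 1)) && coverCheck Ts K₁ ell A B w.1 t Qs N ps

def leafCheck (Ts : List (ℕ × ℕ)) (D : SieveData) (K₁ K₂ ell A B t nxt : ℕ)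
    (Qs : List (List (ℕ × ℕ))) (S N ps : List ℕ) : Bool :=
  leafCheckAux Ts K₁ K₂ ell A B t nxt Qs N ps (D.findWindow S t nxt)

/-- Branch on whether each prime of the last list divides `k`, until a covering closes the case.
`S` and `N` collect the primes dividing and not dividing `k`; `B` and `A` are the product of the
former (with `2`) and its totient. -/
def treeCheck (Ts : List (ℕ × ℕ)) (D : SieveData) (K₁ K₂ ell : ℕ) (Qs : List (List (ℕ × ℕ))) :
    ℕ → ℕ → List ℕ → List ℕ → List ℕ → Bool
  | _, B, _, _, [] => Nat.blt K₂ B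
  | A, B, S, N, p :: ps =>
    Nat.blt K₂ B || (leafCheck Ts D K₁ K₂ ell A B (maxFactors K₂ p 12 B) p Qs S N (p :: ps) ||
      (treeCheck Ts D K₁ K₂ ell Qs (A * (p - 1)) (B * p) (p :: S) N ps &&
        treeCheck Ts D K₁ K₂ ell Qs A B S (N ++ [p]) ps))

/-- The meaning of the arguments of `treeCheck`; `R` is the list of all primes known to divide
`k`. -/
structure TreeInv (k : ℕ) (D : SieveData) (Qs : List (List (ℕ × ℕ))) (A B : ℕ)
    (R S N ps : List ℕ) : Prop where
  even : 2 ∣ k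
  R_nodup : R.Nodup
  R_prime : ∀ p ∈ R, p.Prime ∧ p ∣ k
  R_lt : ∀ p ∈ R, ∀ q ∈ ps, p < q
  R_odd : ∀ p ∈ R, 2 < p
  A_eq : A = (R.map (· - 1)).prod
  B_eq : B = 2 * R.prod
  S_pos : ∀ p ∈ S, 0 < p
  R_sub : ∀ p ∈ R, p ∣ D.b ∨ p ∈ S
  N_nodup : ∀ Q ∈ Qs, (Q.map Prod.fst ++ N).Nodup
  N_prime : ∀ Q ∈ Qs, ∀ p ∈ Q.map Prod.fst ++ N, p.Prime ∧ ¬ p ∣ k ∧ p < 200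
  N_lt : ∀ Q ∈ Qs, ∀ p ∈ Q.map Prod.fst ++ N, ∀ q ∈ ps, p < q
  ps_sorted : ps.Pairwise (· < ·)
  ps_prime : ∀ p ∈ ps, p.Prime ∧ 2 < p ∧ p < 200
  complete : ∀ p, p.Prime → p ∣ k → p = 2 ∨ p ∈ R ∨ p ∈ ps ∨ 200 ≤ p

namespace TreeInv

variable {k : ℕ} {D : SieveData} {Qs : List (List (ℕ × ℕ))} {A B : ℕ} {R S N ps : List ℕ}

lemma two_cons_nodup (h : TreeInv k D Qs A B R S N ps) : (2 :: R).Nodup :=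
  List.nodup_cons.2 ⟨fun h2 => lt_irrefl _ (h.R_odd 2 h2), h.R_nodup⟩

lemma two_cons_prime (h : TreeInv k D Qs A B R S N ps) : ∀ p ∈ 2 :: R, p.Prime ∧ p ∣ k := by
  simpa using ⟨⟨Nat.prime_two, h.even⟩, fun p hp => h.R_prime p hp⟩

lemma le (h : TreeInv k D Qs A B R S N ps) (hk : k ≠ 0) : B ≤ k := by
  have h1 := prod_mul_pow_card_le (nxt := k + 1) hk h.two_cons_nodup fun p hp =>
    ⟨(h.two_cons_prime p hp).1, (h.two_cons_prime p hp).2,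
      Nat.lt_succ_of_le (Nat.le_of_dvd (Nat.pos_of_ne_zero hk) (h.two_cons_prime p hp).2)⟩
  rw [List.prod_cons, ← h.B_eq] at h1
  exact (Nat.le_mul_of_pos_right _ (by positivity)).trans h1

lemma pos (h : TreeInv k D Qs A B R S N ps) : 0 < B := by
  rw [h.B_eq]
  have : 0 < R.prod := List.prod_pos fun p hp => (h.R_prime p hp).1.pos
  omega

lemma totient_mul_le (h : TreeInv k D Qs A B R S N ps) (hk : k ≠ 0) :
    k.totient * B ≤ k * A := by
  have h1 := totient_mul_prod_le hk h.two_cons_nodup h.two_cons_prime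
  simpa [← h.A_eq, ← h.B_eq] using h1

lemma dvd_branch {p : ℕ} (h : TreeInv k D Qs A B R S N (p :: ps)) (hp : p ∣ k) :
    TreeInv k D Qs (A * (p - 1)) (B * p) (p :: R) (p :: S) N ps where
  even := h.even
  R_nodup := List.nodup_cons.2 ⟨fun hR => lt_irrefl _ (h.R_lt p hR p (by simp)), h.R_nodup⟩
  R_prime := by
    simpa using ⟨⟨(h.ps_prime p (by simp)).1, hp⟩, fun q hq => h.R_prime q hq⟩
  R_lt q hq r hr := by
    rcases List.mem_cons.1 hq with rfl | hq
    · exact (List.pairwise_cons.1 h.ps_sorted).1 r hr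
    · exact h.R_lt q hq r (by simp [hr])
  R_odd q hq := by
    rcases List.mem_cons.1 hq with rfl | hq
    · exact (h.ps_prime q (by simp)).2.1
    · exact h.R_odd q hq
  A_eq := by rw [List.map_cons, List.prod_cons, ← h.A_eq, mul_comm]
  B_eq := by rw [List.prod_cons, h.B_eq]; ring
  S_pos q hq := by
    rcases List.mem_cons.1 hq with rfl | hq
    · exact (h.ps_prime q (by simp)).1.pos
    · exact h.S_pos q hq
  R_sub q hq := by
    rcases List.mem_cons.1 hq with rfl | hq
    · simp
    · exact (h.R_sub q hq).imp_right (List.mem_cons_of_mem p)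
  N_nodup := h.N_nodup
  N_prime := h.N_prime
  N_lt Q hQ q hq r hr := h.N_lt Q hQ q hq r (by simp [hr])
  ps_sorted := (List.pairwise_cons.1 h.ps_sorted).2
  ps_prime q hq := h.ps_prime q (by simp [hq])
  complete q hq hqk := by
    have := h.complete q hq hqk
    simp only [List.mem_cons] at this ⊢
    tauto

lemma not_dvd_branch {p : ℕ} (h : TreeInv k D Qs A B R S N (p :: ps)) (hp : ¬ p ∣ k) :
    TreeInv k D Qs A B R S (N ++ [p]) ps where
  even := h.even
  R_nodup := h.R_nodup
  R_prime := h.R_prime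
  R_lt q hq r hr := h.R_lt q hq r (by simp [hr])
  R_odd := h.R_odd
  A_eq := h.A_eq
  B_eq := h.B_eq
  S_pos := h.S_pos
  R_sub := h.R_sub
  N_nodup Q hQ := by
    rw [← List.append_assoc, List.nodup_append']
    refine ⟨h.N_nodup Q hQ, by simp, ?_⟩
    rw [List.disjoint_singleton]
    exact fun hq => lt_irrefl _ (h.N_lt Q hQ p hq p (by simp))
  N_prime Q hQ q hq := by
    rw [← List.append_assoc, List.mem_append, List.mem_singleton] at hq
    rcases hq with hq | rfl
    · exact h.N_prime Q hQ q hq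
    · have := h.ps_prime q (by simp)
      exact ⟨this.1, hp, this.2.2⟩
  N_lt Q hQ q hq r hr := by
    rw [← List.append_assoc, List.mem_append, List.mem_singleton] at hq
    rcases hq with hq | rfl
    · exact h.N_lt Q hQ q hq r (by simp [hr])
    · exact (List.pairwise_cons.1 h.ps_sorted).1 r hr
  ps_sorted := (List.pairwise_cons.1 h.ps_sorted).2
  ps_prime q hq := h.ps_prime q (by simp [hq])
  complete q hq hqk := by
    have := h.complete q hq hqk
    simp only [List.mem_cons] at this ⊢
    rcases this with h1 | h1 | (rfl | h1) | h1
    · tauto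
    · tauto
    · exact absurd hqk hp
    · tauto
    · tauto

end TreeInv

lemma SieveData.Valid.exists_coprime {D : SieveData} (hD : D.Valid) {k nxt t : ℕ}
    {S : List ℕ} {w : ℕ × ℕ} (hk : k ≠ 0) (hw : D.findWindow S t nxt = some w)
    (hS : ∀ p ∈ S, 0 < p) (hnxt : 0 < nxt)
    (hfac : ∀ p, p.Prime → p ∣ k → p ∣ D.b ∨ p ∈ S ∨ nxt ≤ p)
    (ht : (k.primeFactors.filter (nxt ≤ ·)).card ≤ t) (u : ℕ) :
    ∃ i < w.1, (u + i).Coprime k := by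
  obtain ⟨hb, -, hlow, hup⟩ := hD
  have h1 := List.mem_of_find?_eq_some hw
  have h2 := List.find?_some hw
  refine exists_coprime_in_window (b := D.b) (h := w.2) (M := D.maxCount) hk ?_ ?_ hS hnxt
    hfac ht (by simpa [Nat.blt_eq] using h2) u
  · intro u
    rw [← coprimeCount_mod]
    exact hlow w h1 _ (Nat.mod_lt _ hb)
  · intro c v
    by_cases hc : c < D.maxima.length
    · rw [← coprimeCount_mod]
      exact hup c hc _ (Nat.mod_lt _ hb)
    · rw [SieveData.maxCount, List.getD_eq_default _ _ (by omega)]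
      exact (Finset.card_filter_le _ _).trans (by simp)

lemma exists_modEq_of_not_mem_uncovered {Q : List (ℕ × ℕ)} {T j : ℕ} (hj : j < T)
    (h : j ∉ uncovered Q T) : ∃ c ∈ Q, j ≡ c.2 [MOD c.1] := by
  simp only [uncovered, List.mem_filter, List.mem_range, hj, true_and, List.all_eq_true,
    not_forall] at h
  obtain ⟨c, hc, h⟩ := h
  refine ⟨c, hc, ?_⟩
  simp only [Bool.not_eq_true', Bool.not_eq_false, Nat.beq_eq] at h
  rw [Nat.ModEq, ← h, Nat.mod_mod]

/-- Bounds on the logarithms used in the tables. -/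
def ValidLogs (Ts : List (ℕ × ℕ)) : Prop := ∀ x ∈ Ts, 1 ≤ x.1 ∧ LogBound (x.1 + 1) x.2

instance (Ts : List (ℕ × ℕ)) : Decidable (ValidLogs Ts) :=
  inferInstanceAs (Decidable (∀ x ∈ Ts, _))

lemma TreeInv.false_of_leafCheck {Ts : List (ℕ × ℕ)} {k : ℕ} {D : SieveData}
    {Qs : List (List (ℕ × ℕ))} {A B : ℕ} {R S N ps : List ℕ} {nxt t K₁ K₂ ell : ℕ}
    (hTs : ValidLogs Ts) (hD : D.Valid) (hP : IsPInteger k)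
    (h : TreeInv k D Qs A B R S N (nxt :: ps))
    (hK : 10 ^ 7 ≤ K₁) (h1 : K₁ ≤ k) (h2 : k ≤ K₂) (hK₂ : K₂ < 2 ^ 38) (hell : LogBound K₂ ell)
    (hcheck : leafCheck Ts D K₁ K₂ ell A B t nxt Qs S N (nxt :: ps) = true) : False := by
  have hk : k ≠ 0 := by omega
  rw [leafCheck] at hcheck
  rcases hw : D.findWindow S t nxt with _ | w
  · rw [hw] at hcheck
    exact Bool.false_ne_true hcheck
  rw [hw, leafCheckAux, Bool.and_eq_true, Nat.blt_eq, coverCheck, List.any_eq_true] at hcheck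
  obtain ⟨hBt, ⟨T, lt⟩, hT, hcheck⟩ := hcheck
  rw [Bool.and_eq_true, List.any_eq_true] at hcheck
  obtain ⟨-, Q, hQ, hcheck⟩ := hcheck
  set s := (uncovered Q T).length with hs
  rw [fillCheck, boundCheck, Bool.and_eq_true, Bool.and_eq_true, Nat.ble_eq, Nat.ble_eq,
    Nat.ble_eq] at hcheck
  obtain ⟨hlen, hmG, hbound⟩ := hcheck
  obtain ⟨hT1, hlt⟩ := hTs _ hT
  have hnxtpos : 0 < nxt := (h.ps_prime nxt (by simp)).1.pos
  have hsorted := List.pairwise_cons.1 h.ps_sorted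
  have ht : (k.primeFactors.filter (nxt ≤ ·)).card ≤ t := by
    have h3 := prod_mul_pow_card_le (nxt := nxt) hk h.two_cons_nodup fun p hp => by
      refine ⟨(h.two_cons_prime p hp).1, (h.two_cons_prime p hp).2, ?_⟩
      rcases List.mem_cons.1 hp with rfl | hp
      · exact (h.ps_prime nxt (by simp)).2.1
      · exact h.R_lt p hp nxt (by simp)
    rw [List.prod_cons, ← h.B_eq] at h3
    by_contra! hlt'
    have h4 := Nat.mul_le_mul_left B (Nat.pow_le_pow_right hnxtpos hlt')
    exact absurd (hBt.trans_le (h4.trans h3)) h2.not_gt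
  have hge : ∀ p ∈ nxt :: ps, nxt ≤ p := fun p hp => by
    rcases List.mem_cons.1 hp with rfl | hp
    · exact le_rfl
    · exact (hsorted.1 p hp).le
  have hgap : ∀ u, ∃ i < w.1, (u + i).Coprime k := by
    refine hD.exists_coprime hk hw h.S_pos hnxtpos (fun p hp hpk => ?_) ht
    rcases h.complete p hp hpk with rfl | hp | hp | hp
    · exact Or.inl hD.2.1
    · exact (h.R_sub p hp).imp_right Or.inl
    · exact Or.inr (Or.inr (hge p hp))
    · have := (h.ps_prime nxt (by simp)).2.2
      exact Or.inr (Or.inr (by omega))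
  have hfilter : ((nxt :: ps).filter (· ∣ k)).length ≤ t := by
    refine le_trans ?_ ht
    rw [← List.toFinset_card_of_nodup (h.ps_sorted.imp (fun hab => hab.ne) |>.filter _)]
    refine Finset.card_le_card fun p hp => ?_
    simp only [List.mem_toFinset, List.mem_filter, decide_eq_true_eq] at hp
    rw [Finset.mem_filter, Nat.mem_primeFactors]
    exact ⟨⟨(h.ps_prime p hp.1).1, hp.2, hk⟩, hge p hp.1⟩
  obtain ⟨E, hE1, hE2, hE3, hE4⟩ := exists_sublist_not_dvd k (nxt :: ps) t (s - N.length)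
    h.ps_sorted hfilter hlen
  set F := N.take s ++ E with hF
  have hFlen : F.length = s := by
    rw [hF, List.length_append, List.length_take, hE2]
    omega
  set C := Q ++ F.zip (uncovered Q T) with hC
  have hfst : C.map Prod.fst = Q.map Prod.fst ++ F := by
    rw [hC, List.map_append, List.map_fst_zip (by omega)]
  have hQF : Q.map Prod.fst ++ F = (Q.map Prod.fst ++ N.take s) ++ E := by
    rw [hF, List.append_assoc]
  have hsubN : (Q.map Prod.fst ++ N.take s).Sublist (Q.map Prod.fst ++ N) :=
    List.Sublist.append (List.Sublist.refl _) (List.take_sublist _ _)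
  have hprod : (C.map Prod.fst).prod ≤ (Q.map Prod.fst).prod * (N.take s).prod *
      (((nxt :: ps).drop t).take (s - N.length)).prod := by
    rw [hfst, hQF, List.prod_append, List.prod_append]
    exact Nat.mul_le_mul_left _ hE4
  have hnodup : (C.map Prod.fst).Nodup := by
    rw [hfst, hQF, List.nodup_append']
    refine ⟨(h.N_nodup Q hQ).sublist hsubN,
      (h.ps_sorted.imp fun hab => hab.ne).sublist hE1, fun p hp hpE => ?_⟩
    exact lt_irrefl _ (h.N_lt Q hQ p (hsubN.subset hp) p (hE1.subset hpE))
  have hprime : ∀ q ∈ C.map Prod.fst, q.Prime ∧ ¬ q ∣ k ∧ q < 200 := by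
    intro q hq
    rw [hfst, hQF, List.mem_append] at hq
    rcases hq with hq | hq
    · exact h.N_prime Q hQ q (hsubN.subset hq)
    · have := h.ps_prime q (hE1.subset hq)
      exact ⟨this.1, hE3 q hq, this.2.2⟩
  have hmG' := Nat.mul_le_mul_right w.1 hprod
  refine hP.false_of_cover (C := C) (G := w.1) (T := T) (fun c hc => ?_) hnodup hgap
    (fun c hc => ?_) ?_ (fun j hj => ?_) ?_
  · have := hprime c.1 (List.mem_map_of_mem hc)
    exact ⟨this.1, this.2.1⟩
  · have := (hprime c.1 (List.mem_map_of_mem hc)).2.2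
    omega
  · intro h0
    have h3 : 0 ∉ uncovered Q T := by
      rw [h0, List.map_nil] at hfst
      have := List.append_eq_nil_iff.1 hfst.symm
      rw [this.2, List.length_nil] at hFlen
      rw [List.eq_nil_of_length_eq_zero (hs.symm.trans hFlen.symm)]
      simp
    obtain ⟨c, hc, -⟩ := exists_modEq_of_not_mem_uncovered (by omega) h3
    have : c ∈ C := by rw [hC]; exact List.mem_append_left _ hc
    rw [h0] at this
    simp at this
  · by_cases hjU : j ∈ uncovered Q T
    · have h3 : (F.zip (uncovered Q T)).map Prod.snd = uncovered Q T :=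
        List.map_snd_zip (by omega)
      rw [← h3, List.mem_map] at hjU
      obtain ⟨c, hc, rfl⟩ := hjU
      exact ⟨c, List.mem_append_right _ hc, rfl⟩
    · obtain ⟨c, hc, hcj⟩ := exists_modEq_of_not_mem_uncovered hj hjU
      exact ⟨c, List.mem_append_left _ hc, hcj⟩
  · have hω : k.primeFactors.card ≤ 37 := by
      have h3 := two_pow_card_primeFactors_le hk
      have h4 := (Nat.pow_lt_pow_iff_right (by norm_num)).1 (h3.trans_lt (h2.trans_lt hK₂))
      omega
    refine (totient_add_le_primeCounting h.pos hT1 hK h1 h2 (h.totient_mul_le hk) hω hell hlt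
      (by omega) hbound).trans (Nat.monotone_primeCounting ?_)
    exact Nat.sub_le_sub_left hmG' _

lemma TreeInv.false_of_treeCheck {Ts : List (ℕ × ℕ)} {k : ℕ} {D : SieveData}
    {Qs : List (List (ℕ × ℕ))} {A B : ℕ} {R S N ps : List ℕ} {K₁ K₂ ell : ℕ}
    (hTs : ValidLogs Ts) (hD : D.Valid) (hP : IsPInteger k) (h : TreeInv k D Qs A B R S N ps)
    (hK : 10 ^ 7 ≤ K₁) (h1 : K₁ ≤ k) (h2 : k ≤ K₂) (hK₂ : K₂ < 2 ^ 38) (hell : LogBound K₂ ell)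
    (hcheck : treeCheck Ts D K₁ K₂ ell Qs A B S N ps = true) : False := by
  induction ps generalizing A B R S N with
  | nil =>
    rw [treeCheck, Nat.blt_eq] at hcheck
    have := h.le (by omega)
    omega
  | cons p ps ih =>
    rw [treeCheck, Bool.or_eq_true, Bool.or_eq_true, Bool.and_eq_true, Nat.blt_eq] at hcheck
    rcases hcheck with hcheck | hcheck | ⟨hc1, hc2⟩
    · have := h.le (by omega)
      omega
    · exact h.false_of_leafCheck hTs hD hP hK h1 h2 hK₂ hell hcheck
    · by_cases hp : p ∣ k
      · exact ih (h.dvd_branch hp) hc1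
      · exact ih (h.not_dvd_branch hp) hc2

def smallPrimes : List ℕ := [3, 5, 7, 11, 13]

def largePrimes : List ℕ :=
  [17, 19, 23, 29, 31, 37, 41, 43, 47, 53, 59, 61, 67, 71, 73, 79, 83, 89, 97, 101, 103, 107, 109,
    113, 127, 131, 137, 139, 149, 151, 157, 163, 167, 173, 179, 181, 191, 193, 197, 199]

/-- For each set of small primes dividing `k`, choices of residues modulo the others. -/
def residueTable : List (List ℕ × List (List ℕ)) :=
  [([], [[1, 3, 2, 0, 5], [0, 0, 4, 2, 1], [0, 2, 1, 4, 5]]),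
    ([3], [[0, 1, 2, 3], [1, 0, 2, 3]]), ([5], [[0, 1, 2, 4], [1, 2, 0, 3]]),
    ([7], [[0, 2, 1, 4], [1, 3, 0, 2]]), ([11], [[0, 2, 1, 4]]),
    ([13], [[0, 2, 1, 4], [1, 3, 2, 0]]), ([3, 5], [[0, 1, 2]]), ([3, 7], [[0, 1, 2]]),
    ([3, 11], [[0, 1, 2], [1, 0, 2]]), ([3, 13], [[0, 1, 2], [1, 0, 2]]), ([5, 7], [[0, 1, 2]]),
    ([5, 11], [[0, 1, 2]]), ([5, 13], [[0, 1, 2]]), ([7, 11], [[0, 2, 1]]),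
    ([7, 13], [[0, 2, 1], [1, 3, 0]]), ([11, 13], [[0, 2, 1]]), ([3, 5, 7], [[0, 1]]),
    ([3, 5, 11], [[0, 1]]), ([3, 5, 13], [[0, 1]]), ([3, 7, 11], [[0, 1]]),
    ([3, 7, 13], [[0, 1]]), ([3, 11, 13], [[0, 1], [1, 0]]), ([5, 7, 11], [[0, 1]]),
    ([5, 7, 13], [[0, 1]]), ([5, 11, 13], [[0, 1]]), ([7, 11, 13], [[0, 2]]),
    ([3, 5, 7, 11], [[0]]), ([3, 5, 7, 13], [[0]]), ([3, 5, 11, 13], [[0]]),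
    ([3, 7, 11, 13], [[0]]), ([5, 7, 11, 13], [[0]]), ([3, 5, 7, 11, 13], [[]])]

/-- Pairs `(T, L)` with `1000 log (T + 1) ≤ L`. -/
def logTable : List (ℕ × ℕ) :=
  [(1, 694), (2, 1099), (3, 1387), (4, 1610), (5, 1792), (6, 1946), (7, 2080), (8, 2198),
    (9, 2303), (10, 2398), (11, 2485), (12, 2565), (13, 2640), (14, 2709), (15, 2773), (16, 2834)]

def sieveData (S : List ℕ) : SieveData :=
  bif S.elem 3 then
    bif S.elem 5 then
      ⟨30, [(18, 4), (22, 5), (24, 6), (28, 7), (30, 8), (36, 9), (40, 10), (46, 11), (50, 12),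
        (56, 14), (60, 16), (66, 17), (76, 19), (80, 20), (90, 24)],
        [0, 1, 1, 2, 2, 2, 2, 3, 3, 4, 4, 4, 4, 5]⟩
    else
      ⟨6, [(12, 4), (16, 5), (18, 6), (22, 7), (24, 8), (28, 9), (30, 10), (36, 12), (50, 16),
        (56, 18), (66, 22)], [0, 1, 1, 2, 2, 2, 2, 3, 3, 4]⟩
  else
    bif S.elem 5 then
      ⟨10, [(10, 4), (14, 5), (16, 6), (18, 7), (20, 8), (24, 9), (26, 10), (28, 11), (36, 14),
        (50, 20)], [0, 1, 1, 2, 2, 3, 3, 4]⟩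
    else
      ⟨2, [(12, 6), (14, 7), (16, 8), (18, 9), (20, 10), (22, 11)], [0, 1, 1, 2]⟩

/-- The search for all `k` in `[K₁, K₂]` whose small odd prime factors are `e.1`. -/
def entryCheck (K₁ K₂ ell : ℕ) (e : List ℕ × List (List ℕ)) : Bool :=
  treeCheck logTable (sieveData e.1) K₁ K₂ ell
    (e.2.map ((smallPrimes.filter fun p => !e.1.elem p).zip ·)) (e.1.map (· - 1)).prod
    (2 * e.1.prod) (e.1.filter fun p => Nat.blt 5 p) [] largePrimes

def bandsCheck : ℕ → List (ℕ × ℕ) → Bool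
  | _, [] => true
  | K₂, (K₁, ell) :: l => residueTable.all (entryCheck K₁ K₂ ell) && bandsCheck K₁ l

/-- Pairs `(K₁, L)` of the lower end of an interval and a bound for `1000` times the logarithm of
its upper end, which is the previous lower end or `2 * 10 ^ 11`. -/
def bands : List (ℕ × ℕ) :=
  [(133333333333, 26023), (88888888888, 25617), (59259259258, 25212), (39506172838, 24806),
    (26337448558, 24401), (17558299038, 23995), (11705532692, 23590), (7803688461, 23184),
    (5202458974, 22779), (4161967179, 22373), (3963778265, 22150), (3603434786, 22101),
    (2402289857, 22006), (1601526571, 21601), (1067684380, 21195), (711789586, 20790),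
    (474526390, 20384), (316350926, 19979), (210900617, 19573), (156222679, 19168),
    (142020617, 18868), (129109651, 18772), (86073100, 18677), (57382066, 18272),
    (38254710, 17866), (25503140, 17461), (17002093, 17055), (11334728, 16650)]

set_option maxRecDepth 10000 in
lemma validLogs_logTable : ValidLogs logTable := by decide +kernel

lemma valid_sieveData (S : List ℕ) : (sieveData S).Valid := by
  rw [sieveData]
  cases S.elem 3 <;> cases S.elem 5 <;> simp only [cond_true, cond_false] <;> decide +kernel

set_option maxRecDepth 10000 in
lemma exists_mem_residueTable :
    ∀ R ∈ smallPrimes.sublists, ∃ e ∈ residueTable, e.1 = R := by decide +kernel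

set_option maxRecDepth 10000 in
lemma length_of_mem_residueTable : ∀ e ∈ residueTable, ∀ rs ∈ e.2,
    (smallPrimes.filter fun p => !e.1.elem p).length ≤ rs.length := by decide +kernel

set_option maxRecDepth 10000 in
lemma mem_primes_of_lt_two_hundred : ∀ p < 200, p.Prime →
    p = 2 ∨ p ∈ smallPrimes ∨ p ∈ largePrimes := by decide +kernel

lemma smallPrimes_prime : ∀ p ∈ smallPrimes, p.Prime ∧ 2 < p ∧ p < 17 := by
  norm_num [smallPrimes]

set_option maxRecDepth 10000 in
lemma largePrimes_prime : ∀ p ∈ largePrimes, p.Prime ∧ 17 ≤ p ∧ p < 200 := by decide +kernel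

lemma treeInv_of_even {k : ℕ} (hk : 2 ∣ k) {rss : List (List ℕ)} {R : List ℕ}
    (hR : R = smallPrimes.filter (· ∣ k))
    (hrss : ∀ rs ∈ rss, (smallPrimes.filter fun p => !R.elem p).length ≤ rs.length) :
    TreeInv k (sieveData R) (rss.map ((smallPrimes.filter fun p => !R.elem p).zip ·))
      (R.map (· - 1)).prod (2 * R.prod) R (R.filter fun p => Nat.blt 5 p) [] largePrimes := by
  have hRmem : ∀ p, p ∈ R ↔ p ∈ smallPrimes ∧ p ∣ k := by simp [hR]
  have hQ : ∀ Q ∈ rss.map ((smallPrimes.filter fun p => !R.elem p).zip ·),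
      Q.map Prod.fst ++ [] = smallPrimes.filter fun p => !R.elem p := by
    intro Q hQ
    obtain ⟨rs, hrs, rfl⟩ := List.mem_map.1 hQ
    rw [List.append_nil, List.map_fst_zip (hrss rs hrs)]
  have hQmem : ∀ p ∈ smallPrimes.filter (fun p => !R.elem p), p ∈ smallPrimes ∧ ¬ p ∣ k := by
    intro p hp
    rw [List.mem_filter] at hp
    refine ⟨hp.1, fun hpk => ?_⟩
    simpa [hRmem, hp.1, hpk] using hp.2
  have hnodup : smallPrimes.Nodup := by decide
  refine
    { even := hk
      R_nodup := hR ▸ hnodup.filter _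
      R_prime := fun p hp => ⟨(smallPrimes_prime p ((hRmem p).1 hp).1).1, ((hRmem p).1 hp).2⟩
      R_lt := fun p hp q hq => ?_
      R_odd := fun p hp => (smallPrimes_prime p ((hRmem p).1 hp).1).2.1
      A_eq := rfl
      B_eq := rfl
      S_pos := fun p hp => ?_
      R_sub := fun p hp => ?_
      N_nodup := fun Q h => by rw [hQ Q h]; exact hnodup.filter _
      N_prime := fun Q h p hp => ?_
      N_lt := fun Q h p hp q hq => ?_
      ps_sorted := by decide
      ps_prime := fun p hp => ?_
      complete := fun p hp hpk => ?_ }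
  · have := (smallPrimes_prime p ((hRmem p).1 hp).1).2.2
    have := (largePrimes_prime q hq).2.1
    omega
  · exact (smallPrimes_prime p ((hRmem p).1 (List.mem_of_mem_filter hp)).1).1.pos
  · by_cases h5 : 5 < p
    · exact Or.inr (List.mem_filter.2 ⟨hp, by simpa [Nat.blt_eq] using h5⟩)
    · left
      have h1 := ((hRmem p).1 hp).1
      have h2 : p = 3 ∨ p = 5 := by
        simp only [smallPrimes, List.mem_cons, List.not_mem_nil, or_false] at h1
        omega
      rcases h2 with rfl | rfl
      · rw [sieveData, List.elem_eq_true_of_mem hp]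
        cases R.elem 5 <;> decide
      · rw [sieveData, List.elem_eq_true_of_mem hp]
        cases R.elem 3 <;> decide
  · rw [hQ Q h] at hp
    have := smallPrimes_prime p (hQmem p hp).1
    exact ⟨this.1, (hQmem p hp).2, by omega⟩
  · rw [hQ Q h] at hp
    have := smallPrimes_prime p (hQmem p hp).1
    have := largePrimes_prime q hq
    omega
  · have := largePrimes_prime p hp
    exact ⟨this.1, by omega, this.2.2⟩
  · rcases lt_or_ge p 200 with h | h
    · rcases mem_primes_of_lt_two_hundred p h hp with h | h | h
      · exact Or.inl h
      · exact Or.inr (Or.inl ((hRmem p).2 ⟨h, hpk⟩))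
      · exact Or.inr (Or.inr (Or.inl h))
    · exact Or.inr (Or.inr (Or.inr h))

lemma IsPInteger.false_of_entryCheck {k K₁ K₂ ell : ℕ} (hP : IsPInteger k) (hk : 2 ∣ k)
    (hK : 10 ^ 7 ≤ K₁) (h1 : K₁ ≤ k) (h2 : k ≤ K₂) (hK₂ : K₂ < 2 ^ 38) (hell : LogBound K₂ ell)
    (hcheck : residueTable.all (entryCheck K₁ K₂ ell) = true) : False := by
  obtain ⟨e, he, heR⟩ := exists_mem_residueTable (smallPrimes.filter (· ∣ k))
    (List.mem_sublists.2 List.filter_sublist)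
  exact (treeInv_of_even hk heR (length_of_mem_residueTable e he)).false_of_treeCheck
    validLogs_logTable (valid_sieveData _) hP hK h1 h2 hK₂ hell (List.all_eq_true.1 hcheck e he)

/-- The logarithmic bounds in a list of bands below `K₂`. -/
def ValidBands : ℕ → List (ℕ × ℕ) → Prop
  | _, [] => True
  | K₂, x :: l => (K₂ < 2 ^ 38 ∧ 10 ^ 7 ≤ x.1 ∧ LogBound K₂ x.2) ∧ ValidBands x.1 l

instance instDecidableValidBands : (K₂ : ℕ) → (l : List (ℕ × ℕ)) → Decidable (ValidBands K₂ l)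
  | _, [] => inferInstanceAs (Decidable True)
  | _, x :: l =>
    have := instDecidableValidBands x.1 l
    inferInstanceAs (Decidable (_ ∧ _))

lemma IsPInteger.false_of_bandsCheck {k : ℕ} (hP : IsPInteger k) (hk : 2 ∣ k) {l : List (ℕ × ℕ)}
    {K₂ : ℕ} (hl : ValidBands K₂ l) (hcheck : bandsCheck K₂ l = true) (h2 : k ≤ K₂)
    (h1 : (l.map Prod.fst).getLastD K₂ < k) : False := by
  induction l generalizing K₂ with
  | nil =>
    simp at h1
    omega
  | cons x l ih =>
    obtain ⟨⟨hK₂, hx, hell⟩, hl⟩ := hl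
    rw [bandsCheck, Bool.and_eq_true] at hcheck
    rcases le_or_gt x.1 k with h | h
    · exact hP.false_of_entryCheck hk hx h h2 hK₂ hell hcheck.1
    · exact ih hl hcheck.2 h.le (by rwa [List.map_cons, List.getLastD_cons] at h1)

set_option maxRecDepth 100000 in
lemma validBands_bands : ValidBands (2 * 10 ^ 11) bands := by decide +kernel

set_option maxRecDepth 100000 in
lemma bandsCheck_bands : bandsCheck (2 * 10 ^ 11) bands = true := by decide +kernel

lemma IsPInteger.le_of_even {k : ℕ} (hP : IsPInteger k) (hk : 2 ∣ k) (h2 : k ≤ 2 * 10 ^ 11) :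
    k ≤ 11334728 := by
  by_contra! h
  exact hP.false_of_bandsCheck hk validBands_bands bandsCheck_bands h2 h

lemma prime_of_coprime_factorial {n m : ℕ} (hm : 1 < m) (h : m.Coprime n.factorial)
    (hlt : m < (n + 1) ^ 2) : m.Prime := by
  by_contra hp
  have h1 := Nat.minFac_sq_le_self (by omega) hp
  have h2 : m.minFac ≤ n := Nat.lt_succ_iff.1 (lt_of_pow_lt_pow_left₀ 2 (by omega) (h1.trans_lt hlt))
  have h3 := Nat.minFac_prime (by omega : m ≠ 1)
  exact h3.one_lt.ne' (Nat.eq_one_of_dvd_coprimes h (Nat.minFac_dvd m)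
    (Nat.dvd_factorial h3.pos h2))

/-- The odd primes below `L`, if `53 < L ≤ 59 ^ 2`. -/
def oddPrimes (L : ℕ) : List ℕ :=
  [3, 5, 7, 11, 13, 17, 19, 23, 29, 31, 37, 41, 43, 47, 53] ++
    (List.range L).filter fun q => Nat.blt 1 q && Nat.beq (q.gcd (Nat.factorial 58)) 1

lemma prime_of_mem_oddPrimes {L p : ℕ} (hL : L ≤ 59 ^ 2) (hp : p ∈ oddPrimes L) :
    p.Prime ∧ p ≠ 2 := by
  rw [oddPrimes, List.mem_append, List.mem_filter, List.mem_range, Bool.and_eq_true, Nat.blt_eq,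
    Nat.beq_eq] at hp
  rcases hp with hp | ⟨hp, h1, hp'⟩
  · have : ∀ p ∈ [3, 5, 7, 11, 13, 17, 19, 23, 29, 31, 37, 41, 43, 47, 53],
        Nat.Prime p ∧ p ≠ 2 := by norm_num
    exact this p hp
  · refine ⟨prime_of_coprime_factorial h1 hp' (hp.trans_le hL), ?_⟩
    rintro rfl
    exact absurd (Nat.eq_one_of_dvd_coprimes hp' dvd_rfl
      (Nat.dvd_factorial two_pos (by norm_num))) (by norm_num)

lemma lt_of_mem_oddPrimes {L p : ℕ} (hL : 53 < L) (hp : p ∈ oddPrimes L) : p < L := by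
  rw [oddPrimes, List.mem_append, List.mem_filter, List.mem_range] at hp
  rcases hp with hp | hp
  · have : ∀ p ∈ [3, 5, 7, 11, 13, 17, 19, 23, 29, 31, 37, 41, 43, 47, 53], p ≤ 53 := by decide
    exact (this p hp).trans_lt hL
  · exact hp.1

lemma mem_oddPrimes {L p : ℕ} (hp : p.Prime) (h2 : p ≠ 2) (hL : p < L) : p ∈ oddPrimes L := by
  rw [oddPrimes, List.mem_append, List.mem_filter, List.mem_range, Bool.and_eq_true, Nat.blt_eq,
    Nat.beq_eq]
  by_cases h : p.Coprime (Nat.factorial 58)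
  · exact Or.inr ⟨hL, hp.one_lt, h⟩
  · left
    have h1 := (hp.dvd_factorial).1 (not_not.1 (mt hp.coprime_iff_not_dvd.2 h))
    have : ∀ p ≤ 58, p.Prime → p = 2 ∨
        p ∈ [3, 5, 7, 11, 13, 17, 19, 23, 29, 31, 37, 41, 43, 47, 53] := by
      decide +kernel
    exact (this p h1 hp).resolve_left h2

/-- The number whose bit `j < n` is set if `q` divides `2 * (a + j) + 1`. -/
def sieveMask (a n q : ℕ) : ℕ :=
  ((2 ^ (q * (n / q + 1)) - 1) / (2 ^ q - 1)) <<< ((q / 2 + (q - a % q)) % q)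

lemma testBit_geom {q m t : ℕ} (hq : 0 < q) (ht : t < m) :
    ((2 ^ (q * m) - 1) / (2 ^ q - 1)).testBit (q * t) = true := by
  rw [pow_mul, ← Nat.geomSum_eq (Nat.one_lt_two_pow hq.ne' : 2 ≤ 2 ^ q)]
  induction m generalizing t with
  | zero => omega
  | succ m ih =>
    have h1 : (1 : ℕ) < 2 ^ q := Nat.one_lt_two_pow hq.ne'
    rw [geom_sum_succ, Nat.testBit_two_pow_mul_add _ h1]
    cases t with
    | zero => simp [hq]
    | succ t =>
      rw [if_neg (by rw [mul_add]; omega), show q * (t + 1) - q = q * t by rw [mul_add]; omega]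
      exact ih (by omega)

lemma testBit_sieveMask {a n q j : ℕ} (hq : Odd q) (hj : j < n) (h : q ∣ 2 * (a + j) + 1) :
    (sieveMask a n q).testBit j = true := by
  have hq0 := hq.pos
  have h1 : j % q = (q / 2 + (q - a % q)) % q := by
    have h2 : 2 * (a + j) + 1 ≡ 2 * (q / 2) + 1 [MOD q] := by
      rw [Nat.two_mul_div_two_add_one_of_odd hq]
      exact ((Nat.modEq_zero_iff_dvd).2 h).trans ((Nat.modEq_zero_iff_dvd).2 dvd_rfl).symm
    have h3 : a + j ≡ q / 2 [MOD q] :=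
      Nat.ModEq.cancel_left_of_coprime (Nat.coprime_two_right.2 hq)
        (Nat.ModEq.add_right_cancel' 1 h2)
    have h4 := (h3.add_right (q - a % q))
    have h5 : a + j + (q - a % q) = j + q * (a / q + 1) := by
      have := Nat.mod_add_div a q
      have := Nat.mod_lt a hq0
      rw [mul_add]
      omega
    rw [h5] at h4
    rw [← h4, Nat.add_mul_mod_self_left]
  rw [sieveMask, ← h1, Nat.testBit_shiftLeft]
  have h2 := Nat.mod_add_div j q
  have h3 : j - j % q = q * (j / q) := by omega
  rw [h3, testBit_geom hq0 (Nat.lt_succ_of_le (Nat.div_le_div_right hj.le))]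
  simpa using Nat.mod_le j q

/-- The union of the masks of all moduli in a list. -/
def compositeMask (a n : ℕ) : List ℕ → ℕ
  | [] => 0
  | q :: qs => sieveMask a n q ||| compositeMask a n qs

lemma testBit_compositeMask {a n q j : ℕ} {qs : List ℕ} (hqs : q ∈ qs)
    (h : (sieveMask a n q).testBit j = true) : (compositeMask a n qs).testBit j = true := by
  induction qs with
  | nil => simp at hqs
  | cons p qs ih =>
    rw [compositeMask, Nat.testBit_or, Bool.or_eq_true]
    rcases List.mem_cons.1 hqs with rfl | hqs
    · exact Or.inl h
    · exact Or.inr (ih hqs)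

/-- The number whose bit `j < n` tells whether `2 * (a + j) + 1` has no prime factor below `L`. -/
def primeMask (a n L : ℕ) : ℕ := compositeMask a n (oddPrimes L) ^^^ (2 ^ n - 1)

lemma prime_of_testBit_primeMask {a n L j : ℕ} (ha : 0 < a) (hL : L ≤ 59 ^ 2)
    (haL : 2 * (a + n) ≤ L ^ 2) (hj : j < n) (h : (primeMask a n L).testBit j = true) :
    (2 * (a + j) + 1).Prime := by
  by_contra hp
  set m := 2 * (a + j) + 1 with hm
  have h1 := Nat.minFac_sq_le_self (by omega : 0 < m) hp
  have h2 : m.minFac < L := lt_of_pow_lt_pow_left₀ 2 (by omega) (by omega)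
  have h3 := Nat.minFac_prime (by omega : m ≠ 1)
  have h4 : m.minFac ≠ 2 := fun h5 => by
    have := Nat.minFac_dvd m
    rw [h5] at this
    omega
  rw [primeMask, Nat.testBit_xor, testBit_compositeMask (mem_oddPrimes h3 h4 h2)
    (testBit_sieveMask (h3.odd_of_ne_two h4) hj (Nat.minFac_dvd m)),
    Nat.testBit_two_pow_sub_one] at h
  simp [hj] at h

/-- The union of the shifts of `P` by `p / 2`, for the `p` in a list. -/
def shiftUnion (P : ℕ) : List ℕ → ℕ
  | [] => 0
  | p :: ps => P >>> (p / 2) ||| shiftUnion P ps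

lemma exists_of_testBit_shiftUnion {P j : ℕ} {ps : List ℕ}
    (h : (shiftUnion P ps).testBit j = true) : ∃ p ∈ ps, P.testBit (p / 2 + j) = true := by
  induction ps with
  | nil => simp [shiftUnion] at h
  | cons p ps ih =>
    rw [shiftUnion, Nat.testBit_or, Bool.or_eq_true, Nat.testBit_shiftRight] at h
    rcases h with h | h
    · exact ⟨p, by simp, h⟩
    · obtain ⟨q, hq, h⟩ := ih h
      exact ⟨q, by simp [hq], h⟩

/-- Whether the shifts of `P` cover all bits below `W`. The case distinction lets the kernel
evaluate `P` only once. -/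
def shiftCheck (W : ℕ) (ps : List ℕ) : ℕ → Bool
  | 0 => false
  | P + 1 => Nat.beq (shiftUnion (P + 1) ps &&& (2 ^ W - 1)) (2 ^ W - 1)

lemma exists_of_shiftCheck {W P j : ℕ} {ps : List ℕ} (h : shiftCheck W ps P = true) (hj : j < W) :
    ∃ p ∈ ps, P.testBit (p / 2 + j) = true := by
  cases P with
  | zero => exact absurd h Bool.false_ne_true
  | succ P =>
    rw [shiftCheck, Nat.beq_eq] at h
    have h1 := congrArg (Nat.testBit · j) h
    simp only [Nat.testBit_and, Nat.testBit_two_pow_sub_one, hj, decide_true, Bool.and_true] at h1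
    exact exists_of_testBit_shiftUnion h1

lemma exists_prime_add_of_shiftCheck {a W κ : ℕ}
    (h : shiftCheck W (oddPrimes 752) (primeMask a (W + 376) 3371) = true) (ha : 0 < a)
    (haW : 2 * (a + (W + 376)) ≤ 3371 ^ 2) (h1 : a ≤ κ) (h2 : κ < a + W) :
    ∃ p < 752, p.Prime ∧ (p + 2 * κ).Prime := by
  obtain ⟨p, hp, hbit⟩ := exists_of_shiftCheck h (j := κ - a) (by omega)
  have hp1 := prime_of_mem_oddPrimes (by norm_num) hp
  have hp2 := lt_of_mem_oddPrimes (by norm_num) hp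
  refine ⟨p, hp2, hp1.1, ?_⟩
  have h3 := prime_of_testBit_primeMask ha (by norm_num) haW (by omega) hbit
  have h4 := Nat.two_mul_div_two_add_one_of_odd (hp1.1.odd_of_ne_two hp1.2)
  convert h3 using 1
  omega

lemma exists_prime_add {κ : ℕ} (h1 : 1685 ≤ κ) (h2 : κ < 1685 + 6 * 944500) :
    ∃ p < 752, p.Prime ∧ (p + 2 * κ).Prime := by
  obtain ⟨i, hi, h3, h4⟩ : ∃ i < 6, 1685 + i * 944500 ≤ κ ∧ κ < 1685 + i * 944500 + 944500 :=
    ⟨(κ - 1685) / 944500, by omega, by omega, by omega⟩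
  have h5 : ∀ i < 6, shiftCheck 944500 (oddPrimes 752)
      (primeMask (1685 + i * 944500) (944500 + 376) 3371) = true := by
    intro i hi
    interval_cases i <;> decide +kernel
  have h6 : 2 * (1685 + i * 944500 + (944500 + 376)) ≤ 3371 ^ 2 := by
    calc
      _ ≤ 2 * (1685 + 5 * 944500 + (944500 + 376)) := by gcongr; exact Nat.le_of_lt_succ hi
      _ ≤ _ := by norm_num
  exact exists_prime_add_of_shiftCheck (h5 i hi) (by omega) h6 h3 h4

/-- Search for a prime `p` such that `p + k` is prime and the square of some prime not dividing `k`
lies between `p` and `k`. -/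
def pairSearch (k : ℕ) : Bool :=
  (oddPrimes 80).any fun p =>
    ([46, 70].any fun f => Nat.beq ((p + k).gcd f.factorial) 1 && Nat.blt (p + k) ((f + 1) ^ 2)) &&
      [3, 5, 7, 11, 13, 17, 19, 23, 29].any fun q =>
        Nat.blt p (q ^ 2) && (Nat.blt (q ^ 2) k && !Nat.beq (k % q) 0)

lemma IsPInteger.false_of_prime_sq {k p q : ℕ} (hP : IsPInteger k) (hp : p.Prime)
    (hpk : (p + k).Prime) (hq : q.Prime) (hqk : ¬ q ∣ k) (h1 : p < q ^ 2) (h2 : q ^ 2 < k) :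
    False :=
  hP.false_of_prime_pair hp hpk (Nat.Coprime.pow_left 2 ((hq.coprime_iff_not_dvd).2 hqk))
    (Nat.Prime.not_prime_pow le_rfl) h1 h2

lemma IsPInteger.false_of_pairSearch {k : ℕ} (hP : IsPInteger k) (h : pairSearch k = true) :
    False := by
  simp only [pairSearch, List.any_eq_true, Bool.and_eq_true, Nat.beq_eq, Nat.blt_eq,
    Bool.not_eq_true', ← Bool.not_eq_true] at h
  obtain ⟨p, hp, ⟨f, -, hf1, hf2⟩, q, hq, h1, h2, h3⟩ := h
  have hp' := (prime_of_mem_oddPrimes (by norm_num) hp).1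
  have hq' : q.Prime := by
    have : ∀ q ∈ [3, 5, 7, 11, 13, 17, 19, 23, 29], Nat.Prime q := by norm_num
    exact this q hq
  have := hp'.one_lt
  exact hP.false_of_prime_sq hp' (prime_of_coprime_factorial (by omega) hf1 hf2) hq'
    (fun hqk => h3 (Nat.mod_eq_zero_of_dvd hqk)) h1 h2

lemma pairSearch_of_small : ∀ κ < 1685, 21 ≤ κ → pairSearch (2 * κ) = true := by
  decide +kernel

lemma IsPInteger.false_of_small {k : ℕ} (hP : IsPInteger k) (hk : 2 ∣ k) (h1 : 30 < k)
    (h2 : k ≤ 11334728) : False := by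
  obtain ⟨κ, rfl⟩ := hk
  rcases lt_or_ge κ 21 with h | h
  · have : κ = 16 ∨ κ = 17 ∨ κ = 18 ∨ κ = 19 ∨ κ = 20 := by omega
    rcases this with rfl | rfl | rfl | rfl | rfl
    · exact hP.false_of_prime_sq (p := 5) (q := 3) (by norm_num) (by norm_num) (by norm_num)
        (by norm_num) (by norm_num) (by norm_num)
    · exact hP.false_of_prime_sq (p := 3) (q := 3) (by norm_num) (by norm_num) (by norm_num)
        (by norm_num) (by norm_num) (by norm_num)
    · exact hP.false_of_prime_sq (p := 5) (q := 5) (by norm_num) (by norm_num) (by norm_num)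
        (by norm_num) (by norm_num) (by norm_num)
    · exact hP.false_of_prime_sq (p := 3) (q := 3) (by norm_num) (by norm_num) (by norm_num)
        (by norm_num) (by norm_num) (by norm_num)
    · exact hP.false_of_prime_sq (p := 3) (q := 3) (by norm_num) (by norm_num) (by norm_num)
        (by norm_num) (by norm_num) (by norm_num)
  rcases lt_or_ge κ 1685 with h' | h'
  · exact hP.false_of_pairSearch (pairSearch_of_small κ h' h)
  obtain ⟨p, hlt, hp, hpk⟩ := exists_prime_add h' (by omega)
  have : ∃ q ∈ [29, 31, 37, 41, 43], ¬ q ∣ 2 * κ := by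
    by_contra! h3
    simp only [List.mem_cons, List.not_mem_nil, or_false, forall_eq_or_imp, forall_eq] at h3
    obtain ⟨h29, h31, h37, h41, h43⟩ := h3
    have h4 := Nat.Coprime.mul_dvd_of_dvd_of_dvd (by norm_num) h29 h31
    have h5 := Nat.Coprime.mul_dvd_of_dvd_of_dvd (by norm_num) h4 h37
    have h6 := Nat.Coprime.mul_dvd_of_dvd_of_dvd (by norm_num) h5 h41
    have h7 := Nat.Coprime.mul_dvd_of_dvd_of_dvd (by norm_num) h6 h43
    exact absurd ((Nat.le_of_dvd (zero_lt_one.trans hP.1) h7).trans h2) (by norm_num)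
  obtain ⟨q, hq, hqk⟩ := this
  have hq' : q.Prime ∧ 752 < q ^ 2 ∧ q ^ 2 < 2 * 1685 := by
    have : ∀ q ∈ [29, 31, 37, 41, 43], Nat.Prime q ∧ 752 < q ^ 2 ∧ q ^ 2 < 2 * 1685 := by
      norm_num
    exact this q hq
  exact hP.false_of_prime_sq hp hpk hq'.1 hqk (by omega) (by omega)

theorem no_even_PInteger_up_to_2e11 (k : ℕ) (hk : Even k) (h1 : 30 < k)
    (h2 : k ≤ 2 * 10 ^ 11) : ¬ IsPInteger k :=
  fun hP => hP.false_of_small hk.two_dvd h1 (hP.le_of_even hk.two_dvd h2)
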